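/- Let n ≥ 3 be an integer and define G_n(s) = s/√(1 - s^{-(n-2)}) - ∫ from 1 to s of dz/√(1 - z^{-(n-2)}) for s > 1. Then G_n is differentiable on (1,∞) with G_n′(s) = -((n-2)/2) · s^{-(n-2)} · (1 - s^{-(n-2)})^{-3/2} < 0, so G_n is strictly decreasing; moreover, as s → ∞, G_3(s) → -∞, G_4(s) → 0, and G_n(s) → 1 - I_n > 0 for n ≥ 5, where I_n = ∫₁^∞ ((1 - y^{-2})^{-1/(n-2)} - 1) dy. -/

import Mathlib

/-- `G n s = s/√(1 - s^{-(n-2)}) - ∫₁^s dz/√(1 - z^{-(n-2)})`. -/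
noncomputable def G (n : ℕ) (s : ℝ) : ℝ :=
  s / Real.sqrt (1 - (s ^ (n - 2))⁻¹) - ∫ z in (1 : ℝ)..s, 1 / Real.sqrt (1 - (z ^ (n - 2))⁻¹)

/-- `I n = ∫₁^∞ ((1 - y⁻²)^{-1/(n-2)} - 1) dy`. -/
noncomputable def I (n : ℕ) : ℝ :=
  ∫ y in Set.Ioi (1 : ℝ), ((1 - y ^ (-2 : ℝ)) ^ (-(1 : ℝ) / ((n : ℝ) - 2)) - 1)

open MeasureTheory Set Filter Topology in
/-- basic bounds -/
theorem aux_lt (m : ℕ) (hm : m ≠ 0) (z : ℝ) (hz : 1 < z) :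
    0 < 1 - (z ^ m)⁻¹ ∧ 1 - (z ^ m)⁻¹ < 1 := by
  have h1 : 1 < z ^ m := one_lt_pow₀ hz hm
  have h2 : (z ^ m)⁻¹ < 1 := inv_lt_one_of_one_lt₀ h1
  have h3 : 0 < (z ^ m)⁻¹ := by positivity
  constructor <;> linarith

open MeasureTheory Set Filter Topology in
theorem aux_meas (m : ℕ) : Measurable (fun z : ℝ => 1 / Real.sqrt (1 - (z ^ m)⁻¹)) := by
  fun_prop

open MeasureTheory Set Filter Topology in
theorem aux_one_le (m : ℕ) (hm : m ≠ 0) (z : ℝ) (hz : 1 < z) :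
    1 ≤ 1 / Real.sqrt (1 - (z ^ m)⁻¹) := by
  obtain ⟨h1, h2⟩ := aux_lt m hm z hz
  rw [le_div_iff₀ (Real.sqrt_pos.2 h1), one_mul]
  exact Real.sqrt_le_one.2 h2.le

open MeasureTheory Set Filter Topology in
theorem aux_mono (k m : ℕ) (hk : k ≠ 0) (hkm : k ≤ m) (z : ℝ) (hz : 1 < z) :
    1 / Real.sqrt (1 - (z ^ m)⁻¹) ≤ 1 / Real.sqrt (1 - (z ^ k)⁻¹) := by
  obtain ⟨h1, h2⟩ := aux_lt k hk z hz
  apply one_div_le_one_div_of_le (Real.sqrt_pos.2 h1)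
  apply Real.sqrt_le_sqrt
  have : z ^ k ≤ z ^ m := pow_le_pow_right₀ hz.le hkm
  have := inv_anti₀ (by positivity) this
  linarith

open MeasureTheory Set Filter Topology in
theorem aux_ii (m : ℕ) (hm : m ≠ 0) (s : ℝ) (hs : 1 < s) :
    IntervalIntegrable (fun z : ℝ => 1 / Real.sqrt (1 - (z ^ m)⁻¹)) volume 1 s := by
  have h0 : IntervalIntegrable (fun z : ℝ => z ^ (-(1/2) : ℝ)) volume 0 (s - 1) :=
    intervalIntegral.intervalIntegrable_rpow' (by norm_num)
  have h1 := (h0.comp_sub_right 1).const_mul (Real.sqrt s)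
  simp only [zero_add, sub_add_cancel] at h1
  refine h1.mono_fun' (aux_meas m).aestronglyMeasurable ?_
  rw [uIoc_of_le hs.le]
  filter_upwards [ae_restrict_mem measurableSet_Ioc] with z hz
  have hz1 : 0 < z - 1 := by linarith [hz.1]
  rw [Real.norm_of_nonneg (by positivity)]
  refine (aux_mono 1 m one_ne_zero (Nat.one_le_iff_ne_zero.2 hm) z hz.1).trans ?_
  have e : 1 - (z ^ 1)⁻¹ = (z - 1) / z := by
    have : z ≠ 0 := by linarith
    field_simp
  rw [e, Real.sqrt_div hz1.le, one_div_div, Real.rpow_neg hz1.le, ← Real.sqrt_eq_rpow,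
    div_eq_mul_inv]
  gcongr
  exact hz.2

open MeasureTheory Set Filter Topology in
theorem aux_deriv (n : ℕ) (hn : 3 ≤ n) (s : ℝ) (hs : 1 < s) : HasDerivAt (G n)
      (-(((n : ℝ) - 2) / 2) * (s ^ (n - 2))⁻¹ * (1 - (s ^ (n - 2))⁻¹) ^ (-(3 : ℝ) / 2)) s := by
  obtain ⟨m, rfl⟩ : ∃ m, n = m + 1 + 2 := ⟨n - 3, by omega⟩
  have hm : m + 1 ≠ 0 := by omega
  obtain ⟨h1, h2⟩ := aux_lt _ hm s hs
  have hs0 : s ≠ 0 := by linarith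
  have hp : HasDerivAt (fun s : ℝ => 1 - (s ^ (m+1))⁻¹)
      (-(-(((m + 1 : ℕ) : ℝ) * s ^ m) / (s ^ (m+1)) ^ 2)) s := by
    have := ((hasDerivAt_pow (m+1) s).fun_inv (by positivity)).const_sub 1
    simpa using this
  have hq := (hasDerivAt_id s).div (hp.sqrt h1.ne') (Real.sqrt_pos.2 h1).ne'
  have hc : ContinuousAt (fun z : ℝ => 1 / Real.sqrt (1 - (z ^ (m+1))⁻¹)) s :=
    continuousAt_const.div (hp.sqrt h1.ne').continuousAt (Real.sqrt_pos.2 h1).ne'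
  have hI := intervalIntegral.integral_hasDerivAt_right (aux_ii _ hm s hs)
    ((aux_meas (m+1)).stronglyMeasurable.stronglyMeasurableAtFilter) hc
  have := hq.sub hI
  refine (this.congr_deriv ?_)
  simp only [Nat.add_sub_cancel, id]
  have e : (1 - (s ^ (m+1))⁻¹) ^ (-(3 : ℝ) / 2) = ((Real.sqrt (1 - (s ^ (m+1))⁻¹)) ^ 3)⁻¹ := by
    rw [Real.sqrt_eq_rpow, ← Real.rpow_natCast (_ ^ (1 / 2 : ℝ)), ← Real.rpow_mul h1.le, ← Real.rpow_neg h1.le]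
    norm_num
  rw [e]
  have hr := Real.sqrt_pos.2 h1
  set r := Real.sqrt (1 - (s ^ (m+1))⁻¹)
  push_cast
  field_simp
  ring

open MeasureTheory Set Filter Topology in
theorem aux_neg (n : ℕ) (hn : 3 ≤ n) (s : ℝ) (hs : 1 < s) :
      -(((n : ℝ) - 2) / 2) * (s ^ (n - 2))⁻¹ * (1 - (s ^ (n - 2))⁻¹) ^ (-(3 : ℝ) / 2) < 0 := by
  obtain ⟨h1, h2⟩ := aux_lt (n-2) (by omega) s hs
  have : (3 : ℝ) ≤ n := by exact_mod_cast hn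
  have a : 0 < (s ^ (n - 2))⁻¹ := by positivity
  have b := Real.rpow_pos_of_pos h1 (-(3 : ℝ) / 2)
  have c : 0 < ((n : ℝ) - 2) / 2 := by linarith
  have := mul_pos (mul_pos c a) b
  linarith

open MeasureTheory Set Filter Topology in
theorem aux_anti (n : ℕ) (hn : 3 ≤ n) : StrictAntiOn (G n) (Set.Ioi 1) := by
  apply strictAntiOn_of_deriv_neg (convex_Ioi 1)
  · intro s hs
    exact (aux_deriv n hn s hs).continuousAt.continuousWithinAt
  · intro s hs
    rw [interior_Ioi] at hs
    rw [(aux_deriv n hn s hs).deriv]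
    exact aux_neg n hn s hs

open MeasureTheory Set Filter Topology in
theorem aux_three : Filter.Tendsto (G 3) Filter.atTop Filter.atBot := by
  have hd : ∀ s : ℝ, 1 < s → HasDerivAt (fun s => G 3 s + (1/2) * Real.log s) _ s := fun s hs =>
    (aux_deriv 3 le_rfl s hs).add ((Real.hasDerivAt_log (by linarith)).const_mul (1/2))
  have ha : AntitoneOn (fun s => G 3 s + (1/2) * Real.log s) (Ioi 1) := by
    apply antitoneOn_of_deriv_nonpos (convex_Ioi 1)
    · intro s hs
      exact (hd s hs).continuousAt.continuousWithinAt
    · intro s hs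
      rw [interior_Ioi] at hs
      exact (hd s hs).differentiableAt.differentiableWithinAt
    · intro s hs
      rw [interior_Ioi] at hs
      rw [(hd s hs).deriv]
      obtain ⟨h1, h2⟩ := aux_lt 1 one_ne_zero s hs
      have h3 : 1 ≤ (1 - (s ^ 1)⁻¹) ^ (-(3 : ℝ) / 2) :=
        Real.one_le_rpow_of_pos_of_le_one_of_nonpos h1 h2.le (by norm_num)
      have hs' : (1:ℝ) < s := hs
      have h4 : 0 < s⁻¹ := by positivity
      norm_num at h3 ⊢
      nlinarith
  have hb : ∀ᶠ s in atTop, G 3 s ≤ (G 3 2 + (1/2) * Real.log 2) + -((1/2) * Real.log s) := by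
    filter_upwards [eventually_ge_atTop 2] with s hs
    have := ha (show (2:ℝ) ∈ Ioi 1 by norm_num) (show s ∈ Ioi 1 from lt_of_lt_of_le (by norm_num) hs) hs
    simp only at this
    linarith
  refine tendsto_atBot_mono' _ hb ?_
  apply tendsto_atBot_add_const_left
  exact tendsto_neg_atTop_atBot.comp (Real.tendsto_log_atTop.const_mul_atTop (by norm_num))

open MeasureTheory Set Filter Topology in
/-- the case of exponent two -/
theorem aux_two : IntegrableOn (fun z : ℝ => 1 / Real.sqrt (1 - (z ^ 2)⁻¹) - 1) (Ioi 1) ∧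
    ∫ z in Ioi (1 : ℝ), (1 / Real.sqrt (1 - (z ^ 2)⁻¹) - 1) = 1 := by
  have hcont : Continuous (fun y : ℝ => Real.sqrt (y ^ 2 - 1) - y) := by fun_prop
  have hd : ∀ y ∈ Ioi (1:ℝ), HasDerivAt (fun y : ℝ => Real.sqrt (y ^ 2 - 1) - y)
      (1 / Real.sqrt (1 - (y ^ 2)⁻¹) - 1) y := by
    intro y hy
    have hy : 1 < y := hy
    have h0 : 0 < y ^ 2 - 1 := by nlinarith
    have := ((((hasDerivAt_pow 2 y).sub_const 1).sqrt h0.ne').sub (hasDerivAt_id y))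
    refine this.congr_deriv ?_
    have e : 1 - (y ^ 2)⁻¹ = (y ^ 2 - 1) / y ^ 2 := by field_simp
    rw [e, Real.sqrt_div h0.le, Real.sqrt_sq (by linarith)]
    have := Real.sqrt_pos.2 h0
    norm_num
    field_simp
  have hnn : ∀ y ∈ Ioi (1:ℝ), 0 ≤ 1 / Real.sqrt (1 - (y ^ 2)⁻¹) - 1 := fun y hy =>
    sub_nonneg.2 (aux_one_le 2 two_ne_zero y hy)
  have ht : Tendsto (fun y : ℝ => Real.sqrt (y ^ 2 - 1) - y) atTop (𝓝 0) := by
    apply squeeze_zero_norm' (a := fun y : ℝ => y⁻¹) ?_ tendsto_inv_atTop_zero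
    filter_upwards [eventually_gt_atTop 1] with y hy
    have h0 : 0 < y ^ 2 - 1 := by nlinarith
    have hs := Real.sqrt_nonneg (y ^ 2 - 1)
    have hq := Real.sq_sqrt h0.le
    have hle : Real.sqrt (y ^ 2 - 1) ≤ y := Real.sqrt_le_iff.2 ⟨by linarith, by linarith⟩
    rw [Real.norm_of_nonpos (by linarith), inv_eq_one_div, le_div_iff₀ (by linarith)]
    nlinarith
  refine ⟨integrableOn_Ioi_deriv_of_nonneg hcont.continuousWithinAt hd hnn ht, ?_⟩
  rw [integral_Ioi_of_hasDerivAt_of_nonneg hcont.continuousWithinAt hd hnn ht]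
  norm_num

open MeasureTheory Set Filter Topology in
theorem aux_int (m : ℕ) (hm : 2 ≤ m) :
    IntegrableOn (fun z : ℝ => 1 / Real.sqrt (1 - (z ^ m)⁻¹) - 1) (Ioi 1) := by
  refine Integrable.mono' aux_two.1 ((aux_meas m).sub_const 1).aestronglyMeasurable ?_
  filter_upwards [ae_restrict_mem measurableSet_Ioi] with z hz
  rw [Real.norm_of_nonneg (sub_nonneg.2 (aux_one_le m (by omega) z hz))]
  linarith [aux_mono 2 m two_ne_zero hm z hz]

open MeasureTheory Set Filter Topology in
theorem aux_lim (n : ℕ) (hn : 4 ≤ n) : Tendsto (G n) atTop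
    (𝓝 (1 - ∫ z in Ioi (1 : ℝ), (1 / Real.sqrt (1 - (z ^ (n-2))⁻¹) - 1))) := by
  obtain ⟨m, rfl, hm⟩ : ∃ m, n = m + 2 ∧ 2 ≤ m := ⟨n - 2, by omega, by omega⟩
  simp only [Nat.add_sub_cancel]
  have h1 := intervalIntegral_tendsto_integral_Ioi 1 (aux_int m hm) tendsto_id
  have h2 : Tendsto (fun s : ℝ => s / Real.sqrt (1 - (s ^ m)⁻¹) - s) atTop (𝓝 0) := by
    apply squeeze_zero_norm' (a := fun y : ℝ => y⁻¹) ?_ tendsto_inv_atTop_zero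
    filter_upwards [eventually_ge_atTop 2] with s hs
    obtain ⟨a, b⟩ := aux_lt m (by omega) s (by linarith)
    have c := aux_one_le m (by omega) s (by linarith)
    have hu : (s ^ m)⁻¹ ≤ (s ^ 2)⁻¹ :=
      inv_anti₀ (by positivity) (pow_le_pow_right₀ (by linarith) hm)
    have hu2 : (s ^ 2)⁻¹ ≤ 1 / 4 := by
      rw [inv_le_comm₀ (by positivity) (by norm_num)]
      nlinarith
    have hu0 : 0 < (s ^ m)⁻¹ := by linarith
    have hsu : s * (s ^ m)⁻¹ ≤ s⁻¹ := by
      calc s * (s ^ m)⁻¹ ≤ s * (s ^ 2)⁻¹ := by gcongr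
        _ = s⁻¹ := by field_simp
    set u := (s ^ m)⁻¹
    have key : 1 / Real.sqrt (1 - u) ≤ 1 + u := by
      rw [div_le_iff₀ (Real.sqrt_pos.2 a)]
      have : (1 : ℝ) ≤ Real.sqrt ((1 + u) ^ 2 * (1 - u)) := by
        apply Real.le_sqrt_of_sq_le
        nlinarith [mul_pos hu0 hu0, mul_pos hu0 (mul_pos hu0 hu0)]
      rwa [Real.sqrt_mul (by positivity), Real.sqrt_sq (by positivity)] at this
    have e : s / Real.sqrt (1 - u) - s = s * (1 / Real.sqrt (1 - u) - 1) := by ring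
    rw [e, Real.norm_of_nonneg (mul_nonneg (by linarith) (by linarith))]
    refine le_trans ?_ hsu
    gcongr
    linarith
  have h3 := (h2.add_const 1).sub h1
  rw [zero_add] at h3
  refine h3.congr' ?_
  filter_upwards [eventually_gt_atTop 1] with s hs
  simp only [G, Nat.add_sub_cancel, id]
  rw [intervalIntegral.integral_sub (aux_ii m (by omega) s hs) (by simp)]
  simp
  ring

open MeasureTheory Set Filter Topology in
theorem aux_sym (m : ℕ) (hm : 2 ≤ m) :
    ∫ z in Ioi (1 : ℝ), (1 / Real.sqrt (1 - (z ^ m)⁻¹) - 1) = I (m + 2) := by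
  have em : ((m + 2 : ℕ) : ℝ) - 2 = m := by push_cast; ring
  have hm0 : (m : ℝ) ≠ 0 := by positivity
  unfold I
  rw [em]
  have hI : ∫ y in Ioi (1 : ℝ), ((1 - y ^ (-2 : ℝ)) ^ (-(1 : ℝ) / m) - 1) =
      ∫ y in Ioi (1 : ℝ), ((1 - (y ^ 2)⁻¹) ^ (-(1 : ℝ) / m) - 1) := by
    apply setIntegral_congr_fun measurableSet_Ioi
    intro y hy
    have hy : 1 < y := hy
    simp only
    rw [Real.rpow_neg (by linarith), Real.rpow_two]
  have hg : ∀ y : ℝ, 1 < y → 1 ≤ (1 - (y ^ 2)⁻¹) ^ (-(1 : ℝ) / m) := by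
    intro y hy
    obtain ⟨h1, h2⟩ := aux_lt 2 two_ne_zero y hy
    exact Real.one_le_rpow_of_pos_of_le_one_of_nonpos h1 h2.le
      (div_nonpos_of_nonpos_of_nonneg (by norm_num) (by positivity))
  rw [hI, integral_eq_lintegral_of_nonneg_ae, integral_eq_lintegral_of_nonneg_ae]
  rotate_left
  · filter_upwards [ae_restrict_mem measurableSet_Ioi] with y hy
    exact sub_nonneg.2 (hg y hy)
  · exact Measurable.aestronglyMeasurable (by fun_prop)
  · filter_upwards [ae_restrict_mem measurableSet_Ioi] with y hy
    exact sub_nonneg.2 (aux_one_le m (by omega) y hy)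
  · exact Measurable.aestronglyMeasurable (by fun_prop)
  congr 1
  set μ := (volume : Measure ℝ).restrict (Ioi 1) with hμ
  let S : Set (ℝ × ℝ) := {p | 1 < (p.1 ^ m)⁻¹ + (p.2 ^ 2)⁻¹}
  have hS : MeasurableSet S := measurableSet_lt (by fun_prop) (by fun_prop)
  have A := Measure.prod_apply (μ := μ) (ν := μ) hS
  have B := Measure.prod_apply_symm (μ := μ) (ν := μ) hS
  rw [A] at B
  convert B using 1
  · apply lintegral_congr_ae
    filter_upwards [ae_restrict_mem measurableSet_Ioi] with z hz
    have hz : 1 < z := hz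
    obtain ⟨h1, h2⟩ := aux_lt m (by omega) z hz
    rw [hμ, Measure.restrict_apply' measurableSet_Ioi, ← Real.volume_Ioo]
    congr 1
    ext w
    simp only [S, mem_Ioo, mem_inter_iff, mem_preimage, mem_ofPred_eq, mem_Ioi]
    rw [and_comm]
    refine and_congr_left fun hw => ?_
    rw [lt_div_iff₀ (Real.sqrt_pos.2 h1), mul_comm, ← lt_div_iff₀ (by linarith),
      Real.sqrt_lt' (by positivity), div_pow, one_pow, one_div, sub_lt_iff_lt_add, add_comm]
  · apply lintegral_congr_ae
    filter_upwards [ae_restrict_mem measurableSet_Ioi] with w hw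
    have hw : 1 < w := hw
    obtain ⟨h1, h2⟩ := aux_lt 2 two_ne_zero w hw
    rw [hμ, Measure.restrict_apply' measurableSet_Ioi, ← Real.volume_Ioo]
    congr 1
    ext z
    simp only [S, mem_Ioo, mem_inter_iff, mem_preimage, mem_ofPred_eq, mem_Ioi]
    rw [and_comm]
    refine and_congr_left fun hz => ?_
    rw [← pow_lt_pow_iff_left₀ (by linarith) (by positivity) (show m ≠ 0 by omega),
      ← Real.rpow_natCast (_ ^ _), ← Real.rpow_mul h1.le, div_mul_cancel₀ _ hm0,
      Real.rpow_neg_one, lt_inv_comm₀ (by positivity) h1, sub_lt_iff_lt_add]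

open MeasureTheory Set Filter Topology in
theorem aux_I_lt (m : ℕ) (hm : 3 ≤ m) : I (m + 2) < 1 := by
  rw [← aux_sym m (by omega)]
  refine lt_of_lt_of_eq ?_ aux_two.2
  rw [← sub_pos, ← integral_sub aux_two.1 (aux_int m (by omega))]
  rw [setIntegral_pos_iff_support_of_nonneg_ae]
  · have : Ioi (1:ℝ) ⊆ (Function.support fun a : ℝ =>
      1 / Real.sqrt (1 - (a ^ 2)⁻¹) - 1 - (1 / Real.sqrt (1 - (a ^ m)⁻¹) - 1)) ∩ Ioi 1 := by
      intro z hz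
      refine ⟨?_, hz⟩
      have hz : 1 < z := hz
      obtain ⟨h1, h2⟩ := aux_lt 2 two_ne_zero z hz
      have h3 : z ^ 2 < z ^ m := pow_lt_pow_right₀ hz (by omega)
      have h4 := inv_strictAnti₀ (by positivity) h3
      have h5 := one_div_lt_one_div_of_lt (Real.sqrt_pos.2 h1)
        (Real.sqrt_lt_sqrt h1.le (show 1 - (z ^ 2)⁻¹ < 1 - (z ^ m)⁻¹ by linarith))
      rw [Function.mem_support]
      linarith
    refine lt_of_lt_of_le ?_ (measure_mono this)
    simp
  · filter_upwards [ae_restrict_mem measurableSet_Ioi] with z hz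
    have := aux_mono 2 m two_ne_zero (by omega) z hz
    simp only [Pi.zero_apply]
    linarith
  · exact aux_two.1.sub (aux_int m (by omega))

/-- Properties of `G n`: its derivative is
`-((n-2)/2) s^{-(n-2)} (1 - s^{-(n-2)})^{-3/2} < 0`, so `G n` is strictly decreasing,
and as `s → ∞`: `G 3 → -∞`, `G 4 → 0`, `G n → 1 - I n > 0` for `n ≥ 5`. -/
theorem G_deriv_strictAnti_limits (n : ℕ) (hn : 3 ≤ n) :
    (∀ s : ℝ, 1 < s → HasDerivAt (G n)
      (-(((n : ℝ) - 2) / 2) * (s ^ (n - 2))⁻¹ * (1 - (s ^ (n - 2))⁻¹) ^ (-(3 : ℝ) / 2)) s) ∧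
    (∀ s : ℝ, 1 < s →
      -(((n : ℝ) - 2) / 2) * (s ^ (n - 2))⁻¹ * (1 - (s ^ (n - 2))⁻¹) ^ (-(3 : ℝ) / 2) < 0) ∧
    StrictAntiOn (G n) (Set.Ioi 1) ∧
    (n = 3 → Filter.Tendsto (G n) Filter.atTop Filter.atBot) ∧
    (n = 4 → Filter.Tendsto (G n) Filter.atTop (nhds 0)) ∧
    (5 ≤ n → Filter.Tendsto (G n) Filter.atTop (nhds (1 - I n)) ∧ 0 < 1 - I n) := by
  refine ⟨aux_deriv n hn, aux_neg n hn, aux_anti n hn, ?_, ?_, ?_⟩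
  · rintro rfl
    exact aux_three
  · rintro rfl
    have := aux_lim 4 le_rfl
    simpa only [Nat.reduceSub, aux_two.2, sub_self] using this
  · intro h5
    obtain ⟨m, rfl⟩ : ∃ m, n = m + 2 := ⟨n - 2, by omega⟩
    refine ⟨?_, sub_pos.2 (aux_I_lt m (by omega))⟩
    have := aux_lim (m + 2) (by omega)
    rwa [Nat.add_sub_cancel, aux_sym m (by omega)] at this
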